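/- arXiv:2604.14153 — 14 statements merged into one kernel-verified Lean document; each statement's English description precedes it below -/
import Mathlib

section
/- Let W(t) = y1(t)·y5(t) − y2(t)·y4(t). Then for every real t, W is differentiable at t and satisfies the closed linear differential equation W'(t) = 2C·W(t). -/
open Real Filter Topology

theorem stmt0 (C D E F : ℝ) (y1 y2 y3 y4 y5 : ℝ → ℝ)
    (h1 : ∀ t : ℝ, HasDerivAt y1 (C * y1 t - (y3 t + (1/8) * (y1 t ^ 2 + y2 t ^ 2 + y4 t ^ 2 + y5 t ^ 2)) * y2 t - (3/4) * (y1 t * y5 t - y2 t * y4 t) * y4 t + 2 * y2 t) t)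
    (h2 : ∀ t : ℝ, HasDerivAt y2 (C * y2 t + (y3 t + (1/8) * (y1 t ^ 2 + y2 t ^ 2 + y4 t ^ 2 + y5 t ^ 2)) * y1 t - (3/4) * (y1 t * y5 t - y2 t * y4 t) * y5 t + 2 * y1 t) t)
    (h3 : ∀ t : ℝ, HasDerivAt y3 (D * (y1 t * y2 t + y4 t * y5 t) + E * y3 t + F) t)
    (h4 : ∀ t : ℝ, HasDerivAt y4 (C * y4 t - (y3 t + (1/8) * (y1 t ^ 2 + y2 t ^ 2 + y4 t ^ 2 + y5 t ^ 2)) * y5 t + (3/4) * (y1 t * y5 t - y2 t * y4 t) * y1 t + 2 * y5 t) t)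
    (h5 : ∀ t : ℝ, HasDerivAt y5 (C * y5 t + (y3 t + (1/8) * (y1 t ^ 2 + y2 t ^ 2 + y4 t ^ 2 + y5 t ^ 2)) * y4 t + (3/4) * (y1 t * y5 t - y2 t * y4 t) * y2 t + 2 * y4 t) t) :
    ∀ t : ℝ, HasDerivAt (fun s => y1 s * y5 s - y2 s * y4 s)
      (2 * C * (y1 t * y5 t - y2 t * y4 t)) t := by
  intro t
  refine (((h1 t).fun_mul (h5 t)).fun_sub ((h2 t).fun_mul (h4 t))).congr_deriv ?_
  ring
end

section
/- For every real t one has the explicit formula y1(t)·y5(t) − y2(t)·y4(t) = (y1(0)·y5(0) − y2(0)·y4(0)) · exp(2C·t). -/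
open Real Filter Topology

/-- A solution of the linear equation `u' = a u` on the real line is an exponential. -/
theorem eq_mul_exp_of_hasDerivAt {u : ℝ → ℝ} {a : ℝ}
    (hu : ∀ t : ℝ, HasDerivAt u (a * u t) t) (t : ℝ) :
    u t = u 0 * Real.exp (a * t) := by
  have hexp : ∀ s : ℝ, HasDerivAt (fun s => Real.exp (-(a * s))) (Real.exp (-(a * s)) * -a) s :=
    fun s => by simpa using ((hasDerivAt_id s).const_mul a).neg.exp
  have hconst : ∀ s : ℝ, HasDerivAt (fun s => u s * Real.exp (-(a * s))) 0 s :=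
    fun s => ((hu s).mul (hexp s)).congr_deriv (by ring)
  have h : u t * Real.exp (-(a * t)) = u 0 := by
    simpa using is_const_of_deriv_eq_zero (fun s => (hconst s).differentiableAt)
      (fun s => (hconst s).deriv) t 0
  rw [← h, mul_assoc, ← Real.exp_add, neg_add_cancel, Real.exp_zero, mul_one]

theorem stmt1 (C D E F : ℝ) (y1 y2 y3 y4 y5 : ℝ → ℝ)
    (h1 : ∀ t : ℝ, HasDerivAt y1 (C * y1 t - (y3 t + (1/8) * (y1 t ^ 2 + y2 t ^ 2 + y4 t ^ 2 + y5 t ^ 2)) * y2 t - (3/4) * (y1 t * y5 t - y2 t * y4 t) * y4 t + 2 * y2 t) t)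
    (h2 : ∀ t : ℝ, HasDerivAt y2 (C * y2 t + (y3 t + (1/8) * (y1 t ^ 2 + y2 t ^ 2 + y4 t ^ 2 + y5 t ^ 2)) * y1 t - (3/4) * (y1 t * y5 t - y2 t * y4 t) * y5 t + 2 * y1 t) t)
    (h3 : ∀ t : ℝ, HasDerivAt y3 (D * (y1 t * y2 t + y4 t * y5 t) + E * y3 t + F) t)
    (h4 : ∀ t : ℝ, HasDerivAt y4 (C * y4 t - (y3 t + (1/8) * (y1 t ^ 2 + y2 t ^ 2 + y4 t ^ 2 + y5 t ^ 2)) * y5 t + (3/4) * (y1 t * y5 t - y2 t * y4 t) * y1 t + 2 * y5 t) t)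
    (h5 : ∀ t : ℝ, HasDerivAt y5 (C * y5 t + (y3 t + (1/8) * (y1 t ^ 2 + y2 t ^ 2 + y4 t ^ 2 + y5 t ^ 2)) * y4 t + (3/4) * (y1 t * y5 t - y2 t * y4 t) * y2 t + 2 * y4 t) t) :
    ∀ t : ℝ, y1 t * y5 t - y2 t * y4 t = (y1 0 * y5 0 - y2 0 * y4 0) * Real.exp (2 * C * t) := by
  exact eq_mul_exp_of_hasDerivAt (u := fun t => y1 t * y5 t - y2 t * y4 t) fun t =>
    (((h1 t).mul (h5 t)).sub ((h2 t).mul (h4 t))).congr_deriv (by ring)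
end

section
/- If the initial data satisfy y1(0)·y5(0) − y2(0)·y4(0) = 0, then y1(t)·y5(t) − y2(t)·y4(t) = 0 for all real t; that is, the algebraic set {y1·y5 − y2·y4 = 0} is invariant under the flow. -/
open Real Filter Topology

theorem stmt2 (C D E F : ℝ) (y1 y2 y3 y4 y5 : ℝ → ℝ)
    (h1 : ∀ t : ℝ, HasDerivAt y1 (C * y1 t - (y3 t + (1/8) * (y1 t ^ 2 + y2 t ^ 2 + y4 t ^ 2 + y5 t ^ 2)) * y2 t - (3/4) * (y1 t * y5 t - y2 t * y4 t) * y4 t + 2 * y2 t) t)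
    (h2 : ∀ t : ℝ, HasDerivAt y2 (C * y2 t + (y3 t + (1/8) * (y1 t ^ 2 + y2 t ^ 2 + y4 t ^ 2 + y5 t ^ 2)) * y1 t - (3/4) * (y1 t * y5 t - y2 t * y4 t) * y5 t + 2 * y1 t) t)
    (h3 : ∀ t : ℝ, HasDerivAt y3 (D * (y1 t * y2 t + y4 t * y5 t) + E * y3 t + F) t)
    (h4 : ∀ t : ℝ, HasDerivAt y4 (C * y4 t - (y3 t + (1/8) * (y1 t ^ 2 + y2 t ^ 2 + y4 t ^ 2 + y5 t ^ 2)) * y5 t + (3/4) * (y1 t * y5 t - y2 t * y4 t) * y1 t + 2 * y5 t) t)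
    (h5 : ∀ t : ℝ, HasDerivAt y5 (C * y5 t + (y3 t + (1/8) * (y1 t ^ 2 + y2 t ^ 2 + y4 t ^ 2 + y5 t ^ 2)) * y4 t + (3/4) * (y1 t * y5 t - y2 t * y4 t) * y2 t + 2 * y4 t) t)
    (h0 : y1 0 * y5 0 - y2 0 * y4 0 = 0) :
    ∀ t : ℝ, y1 t * y5 t - y2 t * y4 t = 0 := by
  have hW : ∀ t : ℝ, HasDerivAt
      (fun t => (y1 t * y5 t - y2 t * y4 t) * exp (-(2 * C) * t)) 0 t := by
    intro t
    have hexp := ((hasDerivAt_id t).const_mul (-(2 * C))).exp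
    refine ((((h1 t).mul (h5 t)).sub ((h2 t).mul (h4 t))).mul hexp).congr_deriv ?_
    simp only [Pi.mul_apply, Pi.sub_apply, id_eq]
    ring
  intro t
  have hconst := is_const_of_deriv_eq_zero (fun s => (hW s).differentiableAt)
    (fun s => (hW s).deriv) t 0
  simp only [h0, zero_mul] at hconst
  exact (mul_eq_zero.mp hconst).resolve_right (exp_ne_zero _)
end

section
/- Suppose C > 0 and the function t ↦ y1(t)·y5(t) − y2(t)·y4(t) is bounded on [0, ∞). Then y1(0)·y5(0) − y2(0)·y4(0) = 0, and consequently y1(t)·y5(t) − y2(t)·y4(t) = 0 for all t ≥ 0. (This is the key step proving that every point of a limit set satisfies the identity y1·y5 − y2·y4 = 0 when C > 0.) -/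
open Real Filter Topology

/-- A solution of `w' = k * w` is an exponential. -/
theorem eq_mul_exp_of_hasDerivAt_s3 {k : ℝ} {w : ℝ → ℝ} (hw : ∀ t, HasDerivAt w (k * w t) t)
    (t : ℝ) : w t = w 0 * exp (k * t) := by
  have hg : ∀ s, HasDerivAt (fun s => w s * exp (-(k * s))) 0 s := fun s => by
    have he : HasDerivAt (fun s => exp (-(k * s))) (exp (-(k * s)) * -(k * 1)) s :=
      (((hasDerivAt_id s).const_mul k).neg).exp
    exact ((hw s).mul he).congr_deriv (by ring)
  have hc := is_const_of_deriv_eq_zero (fun s => (hg s).differentiableAt)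
    (fun s => (hg s).deriv) t 0
  simp only [mul_zero, neg_zero, exp_zero, mul_one] at hc
  rw [← hc, mul_assoc, ← exp_add, neg_add_cancel, exp_zero, mul_one]

/-- A solution of `w' = k * w` with `0 < k` that is bounded on `[0, ∞)` vanishes at `0`. -/
theorem eq_zero_of_hasDerivAt_of_bounded {k M : ℝ} (hk : 0 < k) {w : ℝ → ℝ}
    (hw : ∀ t, HasDerivAt w (k * w t) t) (hM : ∀ t, 0 ≤ t → |w t| ≤ M) : w 0 = 0 := by
  by_contra h0
  have htend : Tendsto (fun t => |w 0| * exp (k * t)) atTop atTop :=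
    (tendsto_exp_atTop.comp (tendsto_id.const_mul_atTop hk)).const_mul_atTop (abs_pos.mpr h0)
  obtain ⟨t, ht, ht0⟩ := ((htend.eventually_gt_atTop M).and (eventually_ge_atTop 0)).exists
  have hb := hM t ht0
  rw [eq_mul_exp_of_hasDerivAt_s3 hw t, abs_mul, abs_exp] at hb
  exact absurd hb (not_le.mpr ht)

theorem stmt3 (C D E F : ℝ) (y1 y2 y3 y4 y5 : ℝ → ℝ)
    (h1 : ∀ t : ℝ, HasDerivAt y1 (C * y1 t - (y3 t + (1/8) * (y1 t ^ 2 + y2 t ^ 2 + y4 t ^ 2 + y5 t ^ 2)) * y2 t - (3/4) * (y1 t * y5 t - y2 t * y4 t) * y4 t + 2 * y2 t) t)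
    (h2 : ∀ t : ℝ, HasDerivAt y2 (C * y2 t + (y3 t + (1/8) * (y1 t ^ 2 + y2 t ^ 2 + y4 t ^ 2 + y5 t ^ 2)) * y1 t - (3/4) * (y1 t * y5 t - y2 t * y4 t) * y5 t + 2 * y1 t) t)
    (h3 : ∀ t : ℝ, HasDerivAt y3 (D * (y1 t * y2 t + y4 t * y5 t) + E * y3 t + F) t)
    (h4 : ∀ t : ℝ, HasDerivAt y4 (C * y4 t - (y3 t + (1/8) * (y1 t ^ 2 + y2 t ^ 2 + y4 t ^ 2 + y5 t ^ 2)) * y5 t + (3/4) * (y1 t * y5 t - y2 t * y4 t) * y1 t + 2 * y5 t) t)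
    (h5 : ∀ t : ℝ, HasDerivAt y5 (C * y5 t + (y3 t + (1/8) * (y1 t ^ 2 + y2 t ^ 2 + y4 t ^ 2 + y5 t ^ 2)) * y4 t + (3/4) * (y1 t * y5 t - y2 t * y4 t) * y2 t + 2 * y4 t) t)
    (hC : 0 < C)
    (hbdd : ∃ M : ℝ, ∀ t : ℝ, 0 ≤ t → |y1 t * y5 t - y2 t * y4 t| ≤ M) :
    (y1 0 * y5 0 - y2 0 * y4 0 = 0) ∧ ∀ t : ℝ, 0 ≤ t → y1 t * y5 t - y2 t * y4 t = 0 := by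
  obtain ⟨M, hM⟩ := hbdd
  have hw : ∀ t, HasDerivAt (fun s => y1 s * y5 s - y2 s * y4 s)
      (2 * C * (y1 t * y5 t - y2 t * y4 t)) t := fun t =>
    (((h1 t).mul (h5 t)).sub ((h2 t).mul (h4 t))).congr_deriv (by ring)
  have h0 : y1 0 * y5 0 - y2 0 * y4 0 = 0 :=
    eq_zero_of_hasDerivAt_of_bounded (mul_pos two_pos hC) hw hM
  refine ⟨h0, fun t _ => ?_⟩
  have ht := eq_mul_exp_of_hasDerivAt_s3 hw t
  simpa only [h0, zero_mul] using ht
end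

section
/- If C < 0, then y1(t)·y5(t) − y2(t)·y4(t) tends to 0 as t → ∞. -/
open Real Filter Topology

/-- A solution of `f' = a f` with `a < 0` tends to zero at infinity. -/
theorem tendsto_zero_of_hasDerivAt_mul_of_neg {a : ℝ} (ha : a < 0) {f : ℝ → ℝ}
    (hf : ∀ t, HasDerivAt f (a * f t) t) : Tendsto f atTop (𝓝 0) := by
  have hderiv : ∀ t, HasDerivAt (fun s => f s * Real.exp (-(a * s))) 0 t := fun t => by
    have hexp : HasDerivAt (fun s => Real.exp (-(a * s))) (Real.exp (-(a * t)) * -(a * 1)) t :=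
      ((hasDerivAt_id t).const_mul a).neg.exp
    exact ((hf t).mul hexp).congr_deriv (by ring)
  have hconst : ∀ t, f t * Real.exp (-(a * t)) = f 0 := fun t => by
    simpa using is_const_of_deriv_eq_zero (fun s => (hderiv s).differentiableAt)
      (fun s => (hderiv s).deriv) t 0
  have hsol : f = fun t => f 0 * Real.exp (a * t) := funext fun t => by
    rw [← hconst t, mul_assoc, ← Real.exp_add, neg_add_cancel, Real.exp_zero, mul_one]
  rw [hsol]
  simpa using (Real.tendsto_exp_atBot.comp (tendsto_id.const_mul_atTop_of_neg ha)).const_mul (f 0)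

theorem stmt4 (C D E F : ℝ) (y1 y2 y3 y4 y5 : ℝ → ℝ)
    (h1 : ∀ t : ℝ, HasDerivAt y1 (C * y1 t - (y3 t + (1/8) * (y1 t ^ 2 + y2 t ^ 2 + y4 t ^ 2 + y5 t ^ 2)) * y2 t - (3/4) * (y1 t * y5 t - y2 t * y4 t) * y4 t + 2 * y2 t) t)
    (h2 : ∀ t : ℝ, HasDerivAt y2 (C * y2 t + (y3 t + (1/8) * (y1 t ^ 2 + y2 t ^ 2 + y4 t ^ 2 + y5 t ^ 2)) * y1 t - (3/4) * (y1 t * y5 t - y2 t * y4 t) * y5 t + 2 * y1 t) t)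
    (h3 : ∀ t : ℝ, HasDerivAt y3 (D * (y1 t * y2 t + y4 t * y5 t) + E * y3 t + F) t)
    (h4 : ∀ t : ℝ, HasDerivAt y4 (C * y4 t - (y3 t + (1/8) * (y1 t ^ 2 + y2 t ^ 2 + y4 t ^ 2 + y5 t ^ 2)) * y5 t + (3/4) * (y1 t * y5 t - y2 t * y4 t) * y1 t + 2 * y5 t) t)
    (h5 : ∀ t : ℝ, HasDerivAt y5 (C * y5 t + (y3 t + (1/8) * (y1 t ^ 2 + y2 t ^ 2 + y4 t ^ 2 + y5 t ^ 2)) * y4 t + (3/4) * (y1 t * y5 t - y2 t * y4 t) * y2 t + 2 * y4 t) t)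
    (hC : C < 0) :
    Filter.Tendsto (fun t => y1 t * y5 t - y2 t * y4 t) Filter.atTop (nhds 0) := by
  refine tendsto_zero_of_hasDerivAt_mul_of_neg (a := 2 * C) (by linarith) fun t => ?_
  exact (((h1 t).mul (h5 t)).sub ((h2 t).mul (h4 t))).congr_deriv (by ring)
end

section
/- If C ≠ 0 and the solution is periodic, i.e., there exists T > 0 such that yi(t + T) = yi(t) for all real t and all i ∈ {1,2,3,4,5}, then y1(t)·y5(t) − y2(t)·y4(t) = 0 for all real t. (In particular, every periodic orbit lies in the set {y1·y5 − y2·y4 = 0}.) -/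
open Real Filter Topology

/-- A periodic function whose derivative is `k` times itself, with `k ≠ 0`, vanishes identically. -/
theorem eq_zero_of_periodic_of_hasDerivAt_mul {f : ℝ → ℝ} {k T : ℝ} (hk : k ≠ 0) (hT : T ≠ 0)
    (hf : ∀ t, HasDerivAt f (k * f t) t) (hper : Function.Periodic f T) (t : ℝ) : f t = 0 := by
  have hg : ∀ s, HasDerivAt (fun u => f u * Real.exp (-k * u)) 0 s := fun s =>
    ((hf s).mul ((hasDerivAt_id' s).const_mul (-k)).exp).congr_deriv (by ring)
  have hconst : f (t + T) * Real.exp (-k * (t + T)) = f t * Real.exp (-k * t) :=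
    is_const_of_deriv_eq_zero (fun s => (hg s).differentiableAt) (fun s => (hg s).deriv) (t + T) t
  rw [hper t] at hconst
  by_contra hne
  have hexp := Real.exp_injective (mul_left_cancel₀ hne hconst)
  exact mul_ne_zero hk hT (by linarith)

theorem stmt5 (C D E F : ℝ) (y1 y2 y3 y4 y5 : ℝ → ℝ)
    (h1 : ∀ t : ℝ, HasDerivAt y1 (C * y1 t - (y3 t + (1/8) * (y1 t ^ 2 + y2 t ^ 2 + y4 t ^ 2 + y5 t ^ 2)) * y2 t - (3/4) * (y1 t * y5 t - y2 t * y4 t) * y4 t + 2 * y2 t) t)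
    (h2 : ∀ t : ℝ, HasDerivAt y2 (C * y2 t + (y3 t + (1/8) * (y1 t ^ 2 + y2 t ^ 2 + y4 t ^ 2 + y5 t ^ 2)) * y1 t - (3/4) * (y1 t * y5 t - y2 t * y4 t) * y5 t + 2 * y1 t) t)
    (h3 : ∀ t : ℝ, HasDerivAt y3 (D * (y1 t * y2 t + y4 t * y5 t) + E * y3 t + F) t)
    (h4 : ∀ t : ℝ, HasDerivAt y4 (C * y4 t - (y3 t + (1/8) * (y1 t ^ 2 + y2 t ^ 2 + y4 t ^ 2 + y5 t ^ 2)) * y5 t + (3/4) * (y1 t * y5 t - y2 t * y4 t) * y1 t + 2 * y5 t) t)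
    (h5 : ∀ t : ℝ, HasDerivAt y5 (C * y5 t + (y3 t + (1/8) * (y1 t ^ 2 + y2 t ^ 2 + y4 t ^ 2 + y5 t ^ 2)) * y4 t + (3/4) * (y1 t * y5 t - y2 t * y4 t) * y2 t + 2 * y4 t) t)
    (hC : C ≠ 0) (T : ℝ) (hT : 0 < T)
    (hper : ∀ t : ℝ, y1 (t + T) = y1 t ∧ y2 (t + T) = y2 t ∧ y3 (t + T) = y3 t ∧
      y4 (t + T) = y4 t ∧ y5 (t + T) = y5 t) :
    ∀ t : ℝ, y1 t * y5 t - y2 t * y4 t = 0 := by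
  refine eq_zero_of_periodic_of_hasDerivAt_mul (f := fun t => y1 t * y5 t - y2 t * y4 t)
    (mul_ne_zero two_ne_zero hC) hT.ne' (fun t => ?_) (fun t => ?_)
  · exact (((h1 t).mul (h5 t)).sub ((h2 t).mul (h4 t))).congr_deriv (by ring)
  · obtain ⟨e1, e2, -, e4, e5⟩ := hper t
    simp only [e1, e2, e4, e5]
end

section
/- If y1(t)·y5(t) − y2(t)·y4(t) = 0 for all real t, then y1'(t)·y4(t) − y1(t)·y4'(t) = 0 and y2'(t)·y5(t) − y2(t)·y5'(t) = 0 for all real t. -/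
open Real Filter Topology

theorem stmt8 (C D E F : ℝ) (y1 y2 y3 y4 y5 : ℝ → ℝ)
    (h1 : ∀ t : ℝ, HasDerivAt y1 (C * y1 t - (y3 t + (1/8) * (y1 t ^ 2 + y2 t ^ 2 + y4 t ^ 2 + y5 t ^ 2)) * y2 t - (3/4) * (y1 t * y5 t - y2 t * y4 t) * y4 t + 2 * y2 t) t)
    (h2 : ∀ t : ℝ, HasDerivAt y2 (C * y2 t + (y3 t + (1/8) * (y1 t ^ 2 + y2 t ^ 2 + y4 t ^ 2 + y5 t ^ 2)) * y1 t - (3/4) * (y1 t * y5 t - y2 t * y4 t) * y5 t + 2 * y1 t) t)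
    (h3 : ∀ t : ℝ, HasDerivAt y3 (D * (y1 t * y2 t + y4 t * y5 t) + E * y3 t + F) t)
    (h4 : ∀ t : ℝ, HasDerivAt y4 (C * y4 t - (y3 t + (1/8) * (y1 t ^ 2 + y2 t ^ 2 + y4 t ^ 2 + y5 t ^ 2)) * y5 t + (3/4) * (y1 t * y5 t - y2 t * y4 t) * y1 t + 2 * y5 t) t)
    (h5 : ∀ t : ℝ, HasDerivAt y5 (C * y5 t + (y3 t + (1/8) * (y1 t ^ 2 + y2 t ^ 2 + y4 t ^ 2 + y5 t ^ 2)) * y4 t + (3/4) * (y1 t * y5 t - y2 t * y4 t) * y2 t + 2 * y4 t) t)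
    (hW : ∀ t : ℝ, y1 t * y5 t - y2 t * y4 t = 0) :
    ∀ t : ℝ, deriv y1 t * y4 t - y1 t * deriv y4 t = 0 ∧
      deriv y2 t * y5 t - y2 t * deriv y5 t = 0 := by
  intro t
  rw [(h1 t).deriv, (h2 t).deriv, (h4 t).deriv, (h5 t).deriv]
  constructor
  · linear_combination (y3 t + (1/8) * (y1 t ^ 2 + y2 t ^ 2 + y4 t ^ 2 + y5 t ^ 2) - 2
      - (3/4) * (y1 t ^ 2 + y4 t ^ 2)) * hW t
  · linear_combination (y3 t + (1/8) * (y1 t ^ 2 + y2 t ^ 2 + y4 t ^ 2 + y5 t ^ 2) + 2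
      - (3/4) * (y2 t ^ 2 + y5 t ^ 2)) * hW t
end

section
/- Suppose y1(t)·y5(t) − y2(t)·y4(t) = 0 for all real t and y1(t) ≠ 0 for all real t. Then the proportionality relation y4(0)·y1(t) − y1(0)·y4(t) = 0 holds for all real t; that is, y4(t) = K·y1(t) with the constant K = y4(0)/y1(0). -/
open Real Filter Topology

theorem stmt9 (C D E F : ℝ) (y1 y2 y3 y4 y5 : ℝ → ℝ)
    (h1 : ∀ t : ℝ, HasDerivAt y1 (C * y1 t - (y3 t + (1/8) * (y1 t ^ 2 + y2 t ^ 2 + y4 t ^ 2 + y5 t ^ 2)) * y2 t - (3/4) * (y1 t * y5 t - y2 t * y4 t) * y4 t + 2 * y2 t) t)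
    (h2 : ∀ t : ℝ, HasDerivAt y2 (C * y2 t + (y3 t + (1/8) * (y1 t ^ 2 + y2 t ^ 2 + y4 t ^ 2 + y5 t ^ 2)) * y1 t - (3/4) * (y1 t * y5 t - y2 t * y4 t) * y5 t + 2 * y1 t) t)
    (h3 : ∀ t : ℝ, HasDerivAt y3 (D * (y1 t * y2 t + y4 t * y5 t) + E * y3 t + F) t)
    (h4 : ∀ t : ℝ, HasDerivAt y4 (C * y4 t - (y3 t + (1/8) * (y1 t ^ 2 + y2 t ^ 2 + y4 t ^ 2 + y5 t ^ 2)) * y5 t + (3/4) * (y1 t * y5 t - y2 t * y4 t) * y1 t + 2 * y5 t) t)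
    (h5 : ∀ t : ℝ, HasDerivAt y5 (C * y5 t + (y3 t + (1/8) * (y1 t ^ 2 + y2 t ^ 2 + y4 t ^ 2 + y5 t ^ 2)) * y4 t + (3/4) * (y1 t * y5 t - y2 t * y4 t) * y2 t + 2 * y4 t) t)
    (hW : ∀ t : ℝ, y1 t * y5 t - y2 t * y4 t = 0)
    (hne : ∀ t : ℝ, y1 t ≠ 0) :
    ∀ t : ℝ, y4 0 * y1 t - y1 0 * y4 t = 0 ∧ y4 t = (y4 0 / y1 0) * y1 t := by
  have hderiv : ∀ t : ℝ, HasDerivAt (fun s => y4 s / y1 s) 0 t := by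
    intro t
    refine ((h4 t).fun_div (h1 t) (hne t)).congr_deriv ?_
    rw [div_eq_zero_iff]
    left
    linear_combination
      (2 - (y3 t + (1/8) * (y1 t ^ 2 + y2 t ^ 2 + y4 t ^ 2 + y5 t ^ 2))
        + (3/4) * (y1 t ^ 2 + y4 t ^ 2)) * hW t
  intro t
  have hconst : y4 t / y1 t = y4 0 / y1 0 :=
    is_const_of_deriv_eq_zero (fun s => (hderiv s).differentiableAt)
      (fun s => (hderiv s).deriv) t 0
  have hprop : y4 t = (y4 0 / y1 0) * y1 t := (div_eq_iff (hne t)).mp hconst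
  refine ⟨?_, hprop⟩
  have h0 := hne 0
  rw [hprop]
  field_simp
  ring
end

section
/- Suppose y1(t)·y5(t) − y2(t)·y4(t) = 0 for all real t and y2(t) ≠ 0 for all real t. Then the proportionality relation y5(0)·y2(t) − y2(0)·y5(t) = 0 holds for all real t; that is, y5(t) = K·y2(t) with the constant K = y5(0)/y2(0). -/
open Real Filter Topology

theorem stmt10 (C D E F : ℝ) (y1 y2 y3 y4 y5 : ℝ → ℝ)
    (h1 : ∀ t : ℝ, HasDerivAt y1 (C * y1 t - (y3 t + (1/8) * (y1 t ^ 2 + y2 t ^ 2 + y4 t ^ 2 + y5 t ^ 2)) * y2 t - (3/4) * (y1 t * y5 t - y2 t * y4 t) * y4 t + 2 * y2 t) t)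
    (h2 : ∀ t : ℝ, HasDerivAt y2 (C * y2 t + (y3 t + (1/8) * (y1 t ^ 2 + y2 t ^ 2 + y4 t ^ 2 + y5 t ^ 2)) * y1 t - (3/4) * (y1 t * y5 t - y2 t * y4 t) * y5 t + 2 * y1 t) t)
    (h3 : ∀ t : ℝ, HasDerivAt y3 (D * (y1 t * y2 t + y4 t * y5 t) + E * y3 t + F) t)
    (h4 : ∀ t : ℝ, HasDerivAt y4 (C * y4 t - (y3 t + (1/8) * (y1 t ^ 2 + y2 t ^ 2 + y4 t ^ 2 + y5 t ^ 2)) * y5 t + (3/4) * (y1 t * y5 t - y2 t * y4 t) * y1 t + 2 * y5 t) t)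
    (h5 : ∀ t : ℝ, HasDerivAt y5 (C * y5 t + (y3 t + (1/8) * (y1 t ^ 2 + y2 t ^ 2 + y4 t ^ 2 + y5 t ^ 2)) * y4 t + (3/4) * (y1 t * y5 t - y2 t * y4 t) * y2 t + 2 * y4 t) t)
    (hW : ∀ t : ℝ, y1 t * y5 t - y2 t * y4 t = 0)
    (hne : ∀ t : ℝ, y2 t ≠ 0) :
    ∀ t : ℝ, y5 0 * y2 t - y2 0 * y5 t = 0 ∧ y5 t = (y5 0 / y2 0) * y2 t := by
  have hderiv : ∀ t : ℝ, HasDerivAt (fun s => y5 s / y2 s) 0 t := by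
    intro t
    refine ((h5 t).fun_div (h2 t) (hne t)).congr_deriv ?_
    rw [div_eq_zero_iff]
    left
    linear_combination ((3/4) * (y2 t ^ 2 + y5 t ^ 2) - 2
      - (y3 t + (1/8) * (y1 t ^ 2 + y2 t ^ 2 + y4 t ^ 2 + y5 t ^ 2))) * hW t
  intro t
  have hconst : y5 t / y2 t = y5 0 / y2 0 :=
    is_const_of_deriv_eq_zero (fun s => (hderiv s).differentiableAt)
      (fun s => (hderiv s).deriv) t 0
  have hprop : y5 t = (y5 0 / y2 0) * y2 t := (div_eq_iff (hne t)).mp hconst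
  refine ⟨?_, hprop⟩
  have h0 := hne 0
  rw [hprop]
  field_simp
  ring
end

section
/- Dimension reduction (lifting direction): let K be a real constant and let y1, y2, y3 : ℝ → ℝ be differentiable functions satisfying for every real t the reduced three-dimensional system y1' = C·y1 − [y3 + (1/8)(1+K²)(y1²+y2²)]·y2 + 2·y2, y2' = C·y2 + [y3 + (1/8)(1+K²)(y1²+y2²)]·y1 + 2·y1, y3' = D·(1+K²)·y1·y2 + E·y3 + F. Define y4 := K·y1 and y5 := K·y2. Then (y1, y2, y3, y4, y5) satisfies for every real t the full five-dimensional averaged spherical-pendulum–motor system. -/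
open Real Filter Topology

theorem stmt11 (C D E F K : ℝ) (y1 y2 y3 : ℝ → ℝ)
    (h1 : ∀ t : ℝ, HasDerivAt y1 (C * y1 t - (y3 t + (1/8) * (1 + K ^ 2) * (y1 t ^ 2 + y2 t ^ 2)) * y2 t + 2 * y2 t) t)
    (h2 : ∀ t : ℝ, HasDerivAt y2 (C * y2 t + (y3 t + (1/8) * (1 + K ^ 2) * (y1 t ^ 2 + y2 t ^ 2)) * y1 t + 2 * y1 t) t)
    (h3 : ∀ t : ℝ, HasDerivAt y3 (D * (1 + K ^ 2) * (y1 t * y2 t) + E * y3 t + F) t) :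
    (∀ t : ℝ, HasDerivAt y1 (C * y1 t - (y3 t + (1/8) * (y1 t ^ 2 + y2 t ^ 2 + (K * y1 t) ^ 2 + (K * y2 t) ^ 2)) * y2 t - (3/4) * (y1 t * (K * y2 t) - y2 t * (K * y1 t)) * (K * y1 t) + 2 * y2 t) t) ∧
    (∀ t : ℝ, HasDerivAt y2 (C * y2 t + (y3 t + (1/8) * (y1 t ^ 2 + y2 t ^ 2 + (K * y1 t) ^ 2 + (K * y2 t) ^ 2)) * y1 t - (3/4) * (y1 t * (K * y2 t) - y2 t * (K * y1 t)) * (K * y2 t) + 2 * y1 t) t) ∧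
    (∀ t : ℝ, HasDerivAt y3 (D * (y1 t * y2 t + (K * y1 t) * (K * y2 t)) + E * y3 t + F) t) ∧
    (∀ t : ℝ, HasDerivAt (fun s => K * y1 s) (C * (K * y1 t) - (y3 t + (1/8) * (y1 t ^ 2 + y2 t ^ 2 + (K * y1 t) ^ 2 + (K * y2 t) ^ 2)) * (K * y2 t) + (3/4) * (y1 t * (K * y2 t) - y2 t * (K * y1 t)) * y1 t + 2 * (K * y2 t)) t) ∧
    (∀ t : ℝ, HasDerivAt (fun s => K * y2 s) (C * (K * y2 t) + (y3 t + (1/8) * (y1 t ^ 2 + y2 t ^ 2 + (K * y1 t) ^ 2 + (K * y2 t) ^ 2)) * (K * y1 t) + (3/4) * (y1 t * (K * y2 t) - y2 t * (K * y1 t)) * y2 t + 2 * (K * y1 t)) t) := by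
  refine ⟨fun t => ?_, fun t => ?_, fun t => ?_, fun t => ?_, fun t => ?_⟩
  · exact (h1 t).congr_deriv (by ring)
  · exact (h2 t).congr_deriv (by ring)
  · exact (h3 t).congr_deriv (by ring)
  · exact ((h1 t).const_mul K).congr_deriv (by ring)
  · exact ((h2 t).const_mul K).congr_deriv (by ring)
end

section
/- Suppose C ≤ −2 and let V(t) = y1(t)² + y2(t)² + y4(t)² + y5(t)². Then V'(t) ≤ 0 for every real t; in particular V is monotonically nonincreasing on ℝ. -/
open Real Filter Topology

theorem stmt15 (C D E F : ℝ) (y1 y2 y3 y4 y5 : ℝ → ℝ)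
    (h1 : ∀ t : ℝ, HasDerivAt y1 (C * y1 t - (y3 t + (1/8) * (y1 t ^ 2 + y2 t ^ 2 + y4 t ^ 2 + y5 t ^ 2)) * y2 t - (3/4) * (y1 t * y5 t - y2 t * y4 t) * y4 t + 2 * y2 t) t)
    (h2 : ∀ t : ℝ, HasDerivAt y2 (C * y2 t + (y3 t + (1/8) * (y1 t ^ 2 + y2 t ^ 2 + y4 t ^ 2 + y5 t ^ 2)) * y1 t - (3/4) * (y1 t * y5 t - y2 t * y4 t) * y5 t + 2 * y1 t) t)
    (h3 : ∀ t : ℝ, HasDerivAt y3 (D * (y1 t * y2 t + y4 t * y5 t) + E * y3 t + F) t)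
    (h4 : ∀ t : ℝ, HasDerivAt y4 (C * y4 t - (y3 t + (1/8) * (y1 t ^ 2 + y2 t ^ 2 + y4 t ^ 2 + y5 t ^ 2)) * y5 t + (3/4) * (y1 t * y5 t - y2 t * y4 t) * y1 t + 2 * y5 t) t)
    (h5 : ∀ t : ℝ, HasDerivAt y5 (C * y5 t + (y3 t + (1/8) * (y1 t ^ 2 + y2 t ^ 2 + y4 t ^ 2 + y5 t ^ 2)) * y4 t + (3/4) * (y1 t * y5 t - y2 t * y4 t) * y2 t + 2 * y4 t) t)
    (hC : C ≤ -2) :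
    (∀ t : ℝ, deriv (fun s => y1 s ^ 2 + y2 s ^ 2 + y4 s ^ 2 + y5 s ^ 2) t ≤ 0) ∧
      Antitone (fun s => y1 s ^ 2 + y2 s ^ 2 + y4 s ^ 2 + y5 s ^ 2) := by
  have hV (t : ℝ) : HasDerivAt (fun s => y1 s ^ 2 + y2 s ^ 2 + y4 s ^ 2 + y5 s ^ 2)
      (2 * C * (y1 t ^ 2 + y2 t ^ 2 + y4 t ^ 2 + y5 t ^ 2)
        + 8 * (y1 t * y2 t + y4 t * y5 t)) t := by
    refine (((((h1 t).fun_pow 2).fun_add ((h2 t).fun_pow 2)).fun_add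
      ((h4 t).fun_pow 2)).fun_add ((h5 t).fun_pow 2)).congr_deriv ?_
    push_cast
    ring
  have hV_nonpos (t : ℝ) :
      deriv (fun s => y1 s ^ 2 + y2 s ^ 2 + y4 s ^ 2 + y5 s ^ 2) t ≤ 0 := by
    rw [(hV t).deriv]
    have hnonneg : 0 ≤ y1 t ^ 2 + y2 t ^ 2 + y4 t ^ 2 + y5 t ^ 2 := by positivity
    have hmul := mul_le_mul_of_nonneg_right hC hnonneg
    linarith [sq_nonneg (y1 t - y2 t), sq_nonneg (y4 t - y5 t)]
  exact ⟨hV_nonpos, antitone_of_deriv_nonpos (fun t => (hV t).differentiableAt) hV_nonpos⟩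
end

section
/- Suppose C ≤ −2 and let V(t) = y1(t)² + y2(t)² + y4(t)² + y5(t)². Then V'(t) ≤ 2(C+2)·V(t) for every real t, and consequently the Grönwall-type bound V(t) ≤ V(0)·exp(2(C+2)·t) holds for all t ≥ 0. -/
open Real Filter Topology

/-- Grönwall's inequality in differential form, with a globally differentiable function. -/
theorem le_mul_exp_of_hasDerivAt_le {k : ℝ} {V V' : ℝ → ℝ} (hV : ∀ t, HasDerivAt V (V' t) t)
    (hle : ∀ t, V' t ≤ k * V t) {t : ℝ} (ht : 0 ≤ t) : V t ≤ V 0 * Real.exp (k * t) := by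
  have hd (s : ℝ) : HasDerivAt (fun s => V s * Real.exp (-(k * s)))
      ((V' s - k * V s) * Real.exp (-(k * s))) s := by
    have hexp : HasDerivAt (fun s : ℝ => Real.exp (-(k * s))) (Real.exp (-(k * s)) * -(k * 1)) s :=
      (((hasDerivAt_id' s).const_mul k).neg).exp
    exact ((hV s).mul hexp).congr_deriv (by ring)
  have hanti : Antitone fun s => V s * Real.exp (-(k * s)) :=
    antitone_of_hasDerivAt_nonpos hd fun s =>
      mul_nonpos_of_nonpos_of_nonneg (sub_nonpos.2 (hle s)) (Real.exp_pos _).le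
  have h : V t * Real.exp (-(k * t)) ≤ V 0 := by simpa using hanti ht
  rwa [Real.exp_neg, ← div_eq_mul_inv, div_le_iff₀ (Real.exp_pos _)] at h

theorem stmt16 (C D E F : ℝ) (y1 y2 y3 y4 y5 : ℝ → ℝ)
    (h1 : ∀ t : ℝ, HasDerivAt y1 (C * y1 t - (y3 t + (1/8) * (y1 t ^ 2 + y2 t ^ 2 + y4 t ^ 2 + y5 t ^ 2)) * y2 t - (3/4) * (y1 t * y5 t - y2 t * y4 t) * y4 t + 2 * y2 t) t)
    (h2 : ∀ t : ℝ, HasDerivAt y2 (C * y2 t + (y3 t + (1/8) * (y1 t ^ 2 + y2 t ^ 2 + y4 t ^ 2 + y5 t ^ 2)) * y1 t - (3/4) * (y1 t * y5 t - y2 t * y4 t) * y5 t + 2 * y1 t) t)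
    (h3 : ∀ t : ℝ, HasDerivAt y3 (D * (y1 t * y2 t + y4 t * y5 t) + E * y3 t + F) t)
    (h4 : ∀ t : ℝ, HasDerivAt y4 (C * y4 t - (y3 t + (1/8) * (y1 t ^ 2 + y2 t ^ 2 + y4 t ^ 2 + y5 t ^ 2)) * y5 t + (3/4) * (y1 t * y5 t - y2 t * y4 t) * y1 t + 2 * y5 t) t)
    (h5 : ∀ t : ℝ, HasDerivAt y5 (C * y5 t + (y3 t + (1/8) * (y1 t ^ 2 + y2 t ^ 2 + y4 t ^ 2 + y5 t ^ 2)) * y4 t + (3/4) * (y1 t * y5 t - y2 t * y4 t) * y2 t + 2 * y4 t) t)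
    (hC : C ≤ -2) :
    (∀ t : ℝ, deriv (fun s => y1 s ^ 2 + y2 s ^ 2 + y4 s ^ 2 + y5 s ^ 2) t ≤ 2 * (C + 2) * (y1 t ^ 2 + y2 t ^ 2 + y4 t ^ 2 + y5 t ^ 2)) ∧
      ∀ t : ℝ, 0 ≤ t →
        (y1 t ^ 2 + y2 t ^ 2 + y4 t ^ 2 + y5 t ^ 2) ≤ (y1 0 ^ 2 + y2 0 ^ 2 + y4 0 ^ 2 + y5 0 ^ 2) * Real.exp (2 * (C + 2) * t) := by
  have hV (t : ℝ) : HasDerivAt (fun s => y1 s ^ 2 + y2 s ^ 2 + y4 s ^ 2 + y5 s ^ 2)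
      (2 * C * (y1 t ^ 2 + y2 t ^ 2 + y4 t ^ 2 + y5 t ^ 2) + 8 * (y1 t * y2 t + y4 t * y5 t)) t :=
    (((((h1 t).pow 2).add ((h2 t).pow 2)).add ((h4 t).pow 2)).add ((h5 t).pow 2)).congr_deriv
      (by push_cast; ring)
  have hle (t : ℝ) :
      2 * C * (y1 t ^ 2 + y2 t ^ 2 + y4 t ^ 2 + y5 t ^ 2) + 8 * (y1 t * y2 t + y4 t * y5 t) ≤
        2 * (C + 2) * (y1 t ^ 2 + y2 t ^ 2 + y4 t ^ 2 + y5 t ^ 2) := by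
    linarith [sq_nonneg (y1 t - y2 t), sq_nonneg (y4 t - y5 t)]
  exact ⟨fun t => (hV t).deriv.trans_le (hle t), fun t ht => le_mul_exp_of_hasDerivAt_le hV hle ht⟩
end

section
/- Global asymptotic stability of the oscillatory coordinates: if C < −2, then y1(t)² + y2(t)² + y4(t)² + y5(t)² → 0 as t → ∞; in particular each of y1(t), y2(t), y4(t), y5(t) tends to 0 as t → ∞. -/
open Real Filter Topology

/-- A nonnegative function satisfying `V' ≤ k V` with `k < 0` tends to zero at infinity. -/
theorem tendsto_zero_of_hasDerivAt_le_mul {V V' : ℝ → ℝ} {k : ℝ} (hk : k < 0)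
    (hV : ∀ t, HasDerivAt V (V' t) t) (hle : ∀ t, V' t ≤ k * V t) (hnonneg : ∀ t, 0 ≤ V t) :
    Tendsto V atTop (𝓝 0) := by
  have hderiv : ∀ t, HasDerivAt (fun s => V s * Real.exp (-k * s))
      ((V' t - k * V t) * Real.exp (-k * t)) t := fun t => by
    have hexp : HasDerivAt (fun s => Real.exp (-k * s)) (Real.exp (-k * t) * (-k * 1)) t :=
      ((hasDerivAt_id t).const_mul (-k)).exp
    exact ((hV t).mul hexp).congr_deriv (by ring)
  have hanti : Antitone fun s => V s * Real.exp (-k * s) :=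
    antitone_of_hasDerivAt_nonpos hderiv fun t =>
      mul_nonpos_of_nonpos_of_nonneg (sub_nonpos.2 (hle t)) (Real.exp_pos _).le
  have hbound : ∀ᶠ t in atTop, V t ≤ V 0 * Real.exp (k * t) := by
    filter_upwards [eventually_ge_atTop 0] with t ht
    have h : V t * Real.exp (-k * t) ≤ V 0 := by simpa using hanti ht
    calc V t = V t * Real.exp (-k * t) * Real.exp (k * t) := by
          rw [mul_assoc, ← Real.exp_add]; simp
      _ ≤ V 0 * Real.exp (k * t) := by gcongr
  have hlim : Tendsto (fun t => V 0 * Real.exp (k * t)) atTop (𝓝 0) := by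
    simpa using (Real.tendsto_exp_atBot.comp
      (tendsto_id.const_mul_atTop_of_neg hk)).const_mul (V 0)
  exact squeeze_zero' (Eventually.of_forall hnonneg) hbound hlim

/-- A real function whose square is dominated by a function tending to zero tends to zero. -/
theorem tendsto_zero_of_sq_le {α : Type*} {l : Filter α} {f V : α → ℝ}
    (hle : ∀ t, f t ^ 2 ≤ V t) (hV : Tendsto V l (𝓝 0)) : Tendsto f l (𝓝 0) := by
  have hsqrt : Tendsto (fun t => √(V t)) l (𝓝 0) := by
    simpa using hV.sqrt
  exact squeeze_zero_norm (fun t => Real.abs_le_sqrt (hle t)) hsqrt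

theorem stmt17 (C D E F : ℝ) (y1 y2 y3 y4 y5 : ℝ → ℝ)
    (h1 : ∀ t : ℝ, HasDerivAt y1 (C * y1 t - (y3 t + (1/8) * (y1 t ^ 2 + y2 t ^ 2 + y4 t ^ 2 + y5 t ^ 2)) * y2 t - (3/4) * (y1 t * y5 t - y2 t * y4 t) * y4 t + 2 * y2 t) t)
    (h2 : ∀ t : ℝ, HasDerivAt y2 (C * y2 t + (y3 t + (1/8) * (y1 t ^ 2 + y2 t ^ 2 + y4 t ^ 2 + y5 t ^ 2)) * y1 t - (3/4) * (y1 t * y5 t - y2 t * y4 t) * y5 t + 2 * y1 t) t)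
    (h3 : ∀ t : ℝ, HasDerivAt y3 (D * (y1 t * y2 t + y4 t * y5 t) + E * y3 t + F) t)
    (h4 : ∀ t : ℝ, HasDerivAt y4 (C * y4 t - (y3 t + (1/8) * (y1 t ^ 2 + y2 t ^ 2 + y4 t ^ 2 + y5 t ^ 2)) * y5 t + (3/4) * (y1 t * y5 t - y2 t * y4 t) * y1 t + 2 * y5 t) t)
    (h5 : ∀ t : ℝ, HasDerivAt y5 (C * y5 t + (y3 t + (1/8) * (y1 t ^ 2 + y2 t ^ 2 + y4 t ^ 2 + y5 t ^ 2)) * y4 t + (3/4) * (y1 t * y5 t - y2 t * y4 t) * y2 t + 2 * y4 t) t)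
    (hC : C < -2) :
    Filter.Tendsto (fun t => y1 t ^ 2 + y2 t ^ 2 + y4 t ^ 2 + y5 t ^ 2) Filter.atTop (nhds 0) ∧
      Filter.Tendsto y1 Filter.atTop (nhds 0) ∧
      Filter.Tendsto y2 Filter.atTop (nhds 0) ∧
      Filter.Tendsto y4 Filter.atTop (nhds 0) ∧
      Filter.Tendsto y5 Filter.atTop (nhds 0) := by
  have hV : Tendsto (fun t => y1 t ^ 2 + y2 t ^ 2 + y4 t ^ 2 + y5 t ^ 2) atTop (𝓝 0) := by
    refine tendsto_zero_of_hasDerivAt_le_mul (k := 2 * C + 4)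
      (V' := fun t => 2 * C * (y1 t ^ 2 + y2 t ^ 2 + y4 t ^ 2 + y5 t ^ 2) +
        8 * (y1 t * y2 t + y4 t * y5 t)) (by linarith) (fun t => ?_) (fun t => ?_)
      (fun t => by positivity)
    · exact (((((h1 t).pow 2).add ((h2 t).pow 2)).add ((h4 t).pow 2)).add
        ((h5 t).pow 2)).congr_deriv (by norm_num; ring)
    · nlinarith [sq_nonneg (y1 t - y2 t), sq_nonneg (y4 t - y5 t)]
  refine ⟨hV, ?_, ?_, ?_, ?_⟩ <;> refine tendsto_zero_of_sq_le (fun t => ?_) hV <;>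
    linarith [sq_nonneg (y1 t), sq_nonneg (y2 t), sq_nonneg (y4 t), sq_nonneg (y5 t)]
end

section
/- Convergence of the motor coordinate: let E < 0 and let g, y3 : ℝ → ℝ with g continuous, g(t) → 0 as t → ∞, and y3 differentiable satisfying y3'(t) = g(t) + E·y3(t) + F for all real t. Then y3(t) → −F/E as t → ∞. (Applied with g = D·(y1·y2 + y4·y5), which tends to 0 when C < −2, this shows all trajectories approach the equilibrium (0, 0, −F/E, 0, 0).) -/
open Real Filter Topology

/-- A solution of `z' = g + E z` with `E < 0` and `g → 0` is eventually below any `ε > 0`. -/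
lemma eventually_lt_of_hasDerivAt_add_mul {E : ℝ} (hE : E < 0) {g z : ℝ → ℝ}
    (hg : Tendsto g atTop (𝓝 0)) (hz : ∀ t, HasDerivAt z (g t + E * z t) t)
    {ε : ℝ} (hε : 0 < ε) : ∀ᶠ t in atTop, z t < ε := by
  have hpos : 0 < -E * (ε / 2) := mul_pos (neg_pos.2 hE) (half_pos hε)
  obtain ⟨T, hT⟩ := eventually_atTop.1 (hg.eventually_lt_const hpos)
  have hv (t : ℝ) : HasDerivAt (fun t => (z t - ε / 2) * exp (-E * t))
      ((g t + E * (ε / 2)) * exp (-E * t)) t := by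
    have h := ((hz t).sub_const (ε / 2)).mul (((hasDerivAt_id t).const_mul (-E)).exp)
    refine h.congr_deriv ?_
    simp only [id]
    ring
  have hanti : AntitoneOn (fun t => (z t - ε / 2) * exp (-E * t)) (Set.Ici T) := by
    refine antitoneOn_of_hasDerivWithinAt_nonpos (convex_Ici T)
      (fun t _ => (hv t).continuousAt.continuousWithinAt)
      (fun t _ => (hv t).hasDerivWithinAt) fun t ht => ?_
    have := hT t (interior_subset ht)
    exact mul_nonpos_of_nonpos_of_nonneg (by linarith) (exp_pos _).le
  set c := (z T - ε / 2) * exp (-E * T)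
  have hexp : Tendsto (fun t => c * exp (E * t)) atTop (𝓝 0) := by
    simpa using (tendsto_exp_atBot.comp (tendsto_id.const_mul_atTop_of_neg hE)).const_mul c
  filter_upwards [eventually_ge_atTop T, hexp.eventually_lt_const (half_pos hε)] with t ht hc
  have h : (z t - ε / 2) * exp (-E * t) ≤ c := hanti Set.self_mem_Ici ht ht
  have h' := mul_le_mul_of_nonneg_right h (exp_pos (E * t)).le
  rw [mul_assoc, ← exp_add, show -E * t + E * t = 0 by ring, exp_zero, mul_one] at h'
  linarith

theorem stmt18 (E F : ℝ) (hE : E < 0) (g y3 : ℝ → ℝ)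
    (hg : Continuous g)
    (hg0 : Filter.Tendsto g Filter.atTop (nhds 0))
    (h3 : ∀ t : ℝ, HasDerivAt y3 (g t + E * y3 t + F) t) :
    Filter.Tendsto y3 Filter.atTop (nhds (-F / E)) := by
  have hz (t : ℝ) : HasDerivAt (fun t => y3 t - -F / E) (g t + E * (y3 t - -F / E)) t := by
    refine ((h3 t).sub_const (-F / E)).congr_deriv ?_
    field_simp [hE.ne]
    ring
  have hz' (t : ℝ) :
      HasDerivAt (fun t => -(y3 t - -F / E)) (-g t + E * -(y3 t - -F / E)) t :=
    (hz t).fun_neg.congr_deriv (by ring)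
  refine Metric.tendsto_nhds.2 fun ε hε => ?_
  filter_upwards [eventually_lt_of_hasDerivAt_add_mul hE hg0 hz hε,
    eventually_lt_of_hasDerivAt_add_mul hE (by simpa using hg0.neg) hz' hε] with t h h'
  rw [Real.dist_eq]
  exact abs_lt.2 ⟨by linarith, h⟩
end
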